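/- arXiv:1410.8780 — 2 statements merged into one kernel-verified Lean document; each statement's English description precedes it below -/
import Mathlib

section
/- Every skew Heyting algebra (S;∧,∨,→,1) satisfies: for all x, y, z ∈ S, x ⪯ y→z if and only if x∧y ⪯ z. In particular, x→y = 1 if and only if x ⪯ y. -/
/-- A skew lattice: both operations idempotent, associative, with the four absorption laws. -/
structure SkewLattice (S : Type*) where
  m : S → S → S  -- meet ∧
  j : S → S → S  -- join ∨
  m_idem : ∀ x, m x x = x
  j_idem : ∀ x, j x x = x
  m_assoc : ∀ x y z, m (m x y) z = m x (m y z)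
  j_assoc : ∀ x y z, j (j x y) z = j x (j y z)
  abs1 : ∀ x y, m x (j x y) = x
  abs2 : ∀ x y, j x (m x y) = x
  abs3 : ∀ x y, j (m x y) y = y
  abs4 : ∀ x y, m (j x y) y = y

namespace SkewLattice

variable {S : Type*}

/-- Natural partial order: x ≤ y iff x∨y = y = y∨x. -/
def nle (L : SkewLattice S) (x y : S) : Prop := L.j x y = y ∧ L.j y x = y

/-- Natural preorder: x ⪯ y iff y∨x∨y = y. -/
def npre (L : SkewLattice S) (x y : S) : Prop := L.j (L.j y x) y = y

/-- Green's relation D: x D y iff x ⪯ y and y ⪯ x. -/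
def dRel (L : SkewLattice S) (x y : S) : Prop := L.npre x y ∧ L.npre y x

/-- Green's relation L. -/
def lRel (L : SkewLattice S) (x y : S) : Prop := L.m x y = x ∧ L.m y x = y

/-- Green's relation R. -/
def rRel (L : SkewLattice S) (x y : S) : Prop := L.m x y = y ∧ L.m y x = x

/-- Co-strong distributivity. -/
def CoStronglyDistributive (L : SkewLattice S) : Prop :=
  (∀ x y z, L.j x (L.m y z) = L.m (L.j x y) (L.j x z)) ∧
  (∀ x y z, L.j (L.m x y) z = L.m (L.j x z) (L.j y z))

/-- Conormality: x∨y∨z∨w = x∨z∨y∨w. -/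
def Conormal (L : SkewLattice S) : Prop :=
  ∀ x y z w, L.j (L.j (L.j x y) z) w = L.j (L.j (L.j x z) y) w

/-- t is a top: x∨t = t = t∨x for all x. -/
def IsTop (L : SkewLattice S) (t : S) : Prop := ∀ x, L.j x t = t ∧ L.j t x = t

/-- `h` is a skew Heyting implication for the skew lattice `L`:
(i) x→y = (y∨x∨y)→y, and (ii) whenever y ≤ x, x→y is the greatest element w
of the upset y↑ satisfying w∧x ≤ y. -/
def IsSkewHeytingImp (L : SkewLattice S) (h : S → S → S) : Prop :=
  (∀ x y, h x y = h (L.j (L.j y x) y) y) ∧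
  (∀ x y, L.nle y x →
     L.nle y (h x y) ∧ L.nle (L.m (h x y) x) y ∧
     ∀ w, L.nle y w → L.nle (L.m w x) y → L.nle w (h x y))

end SkewLattice

open SkewLattice

/-- A skew Heyting algebra: a co-strongly distributive skew lattice with top 1 together
with an implication satisfying (i) and (ii) above. -/
structure SkewHeytingAlgebra (S : Type*) extends SkewLattice S where
  himp : S → S → S
  one : S
  costrong : toSkewLattice.CoStronglyDistributive
  top : toSkewLattice.IsTop one
  himp_spec : toSkewLattice.IsSkewHeytingImp himp

namespace SkewLattice

variable {S : Type*} (L : SkewLattice S)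

theorem m_eq_of_nle {x y : S} (h : L.nle x y) : L.m x y = x ∧ L.m y x = x := by
  have h₁ := L.abs1 x y
  have h₂ := L.abs4 y x
  rw [h.1] at h₁
  rw [h.2] at h₂
  exact ⟨h₁, h₂⟩

theorem npre_of_nle_sandwich {x z h : S} (hz : L.nle z h)
    (hx : L.nle (L.j (L.j z x) z) h) : L.npre x h := by
  have h₁ : L.j (L.j h x) z = h := by
    have e := hx.2
    rwa [← L.j_assoc, ← L.j_assoc, hz.2] at e
  unfold npre
  calc L.j (L.j h x) h = L.j (L.j h x) (L.j z h) := by rw [hz.1]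
    _ = h := by rw [← L.j_assoc, h₁, L.j_idem]

/-- In a co-strongly distributive skew lattice, the natural preorder restricts to the natural
partial order on every principal upset. -/
theorem nle_sandwich_of_npre (hL : L.CoStronglyDistributive) {x z h : S} (hz : L.nle z h)
    (hx : L.npre x h) : L.nle (L.j (L.j z x) z) h := by
  have mz := L.m_eq_of_nle hz
  unfold npre at hx
  have right : L.j (L.j h x) z = h := by
    set k := L.j (L.j h x) z with hk
    have hhk : L.j h k = k := by rw [hk, ← L.j_assoc, ← L.j_assoc, L.j_idem]
    have hkh : L.j k h = h := by rw [hk, L.j_assoc, hz.1, hx]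
    have hzk : L.nle z k := by
      constructor
      · rw [hk, ← L.j_assoc, ← L.j_assoc, hz.1]
      · rw [hk, L.j_assoc, L.j_idem]
    have e := hL.1 h k z
    have ma := L.abs1 k h
    rw [hkh] at ma
    rw [(L.m_eq_of_nle hzk).2, hz.2, hhk, ma] at e
    exact e.symm
  have left : L.j (L.j z x) h = h := by
    set k := L.j (L.j z x) h with hk
    have hhk : L.j h k = h := by rw [hk, ← L.j_assoc, ← L.j_assoc, hz.2, hx]
    have hkh : L.j k h = k := by rw [hk, L.j_assoc, L.j_idem]
    have hzk : L.nle z k := by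
      constructor
      · rw [hk, ← L.j_assoc, ← L.j_assoc, L.j_idem]
      · rw [hk, L.j_assoc, hz.2]
    have e := hL.2 z k h
    have ma := L.abs4 h k
    rw [hhk] at ma
    rw [(L.m_eq_of_nle hzk).1, hz.1, hkh, ma] at e
    exact e.symm
  constructor
  · rw [L.j_assoc, hz.1, left]
  · rw [← L.j_assoc, ← L.j_assoc, hz.2, right]

theorem nle_sandwich (x z : S) : L.nle z (L.j (L.j z x) z) := by
  constructor
  · rw [← L.j_assoc, ← L.j_assoc, L.j_idem]
  · rw [L.j_assoc, L.j_idem]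

theorem m_sandwich (hL : L.CoStronglyDistributive) (x y z : S) :
    L.m (L.j (L.j z x) z) (L.j (L.j z y) z) = L.j (L.j z (L.m x y)) z := by
  rw [hL.1, hL.2]

theorem nle_iff_npre_of_sandwich (x z : S) :
    L.nle (L.j (L.j z x) z) z ↔ L.npre x z := by
  unfold npre nle
  rw [(L.nle_sandwich x z).1, (L.nle_sandwich x z).2, and_self]

end SkewLattice

theorem SkewHeytingAlgebra.npre_himp_iff {S : Type*} (A : SkewHeytingAlgebra S) (x y z : S) :
    A.toSkewLattice.npre x (A.himp y z) ↔ A.toSkewLattice.npre (A.m x y) z := by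
  set L := A.toSkewLattice
  rw [A.himp_spec.1 y z, ← L.nle_iff_npre_of_sandwich (L.m x y) z, ← L.m_sandwich A.costrong]
  obtain ⟨hz, hm, hmax⟩ := A.himp_spec.2 _ z (L.nle_sandwich y z)
  constructor
  · intro hx
    have hle := L.nle_sandwich_of_npre A.costrong hz hx
    have e := (L.m_eq_of_nle hle).1
    have hzu := L.nle_sandwich y z
    have hm' : L.m (A.himp (L.j (L.j z y) z) z) (L.j (L.j z y) z) = z := by
      have h₁ := A.costrong.1 z (A.himp (L.j (L.j z y) z) z) (L.j (L.j z y) z)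
      rw [hz.1, hzu.1] at h₁
      exact h₁.symm.trans hm.2
    rw [← e, L.m_assoc, hm', (L.m_eq_of_nle (L.nle_sandwich x z)).2]
    exact ⟨L.j_idem z, L.j_idem z⟩
  · intro hx
    exact L.npre_of_nle_sandwich hz (hmax _ (L.nle_sandwich x z) hx)

/-- every skew Heyting algebra satisfies (SHA): x ⪯ y→z iff
x∧y ⪯ z; in particular x→y = 1 iff x ⪯ y. -/
theorem stmt_14 {S : Type*} (A : SkewHeytingAlgebra S) (x y z : S) :
    (A.toSkewLattice.npre x (A.himp y z) ↔ A.toSkewLattice.npre (A.m x y) z) ∧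
    (A.himp x y = A.one ↔ A.toSkewLattice.npre x y) := by
  refine ⟨A.npre_himp_iff x y z, ?_⟩
  have one_m : A.m A.one x = x := by
    have e := A.abs4 A.one x
    rwa [(A.top x).2] at e
  have key := A.npre_himp_iff A.one x y
  rw [one_m] at key
  rw [← key]
  unfold npre
  rw [(A.top _).1, (A.top _).2]
  exact eq_comm
end

section
/- Let (S;∧,∨,1) be a finite co-strongly distributive skew lattice with top 1 (more generally, one whose relation D has only finitely many equivalence classes). Then there exists a binary operation → on S making (S;∧,∨,→,1) a skew Heyting algebra. -/
open SkewLattice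

namespace SkewLattice

variable {S : Type*} {L : SkewLattice S} {u x y : S}

theorem CoStronglyDistributive.j_comm (hcs : L.CoStronglyDistributive)
    (hx : L.nle u x) (hy : L.nle u y) : L.j x y = L.j y x := by
  -- any `a` above `u` satisfies `a ≤ a ∨ b` for every `b` above `u`
  have meet_left : ∀ a b, L.nle u a → L.nle u b → L.m (L.j a b) a = a := by
    intro a b ha hb
    have hbu : L.m b u = u := by
      have h := L.abs4 b u
      rwa [hb.2] at h
    have h := hcs.1 a b u
    rw [hbu, ha.2] at h
    exact h.symm
  have join_left : L.j (L.j x y) x = L.j x y := by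
    have h := L.abs2 (L.j x y) x
    rwa [meet_left x y hx hy] at h
  have meet_right : L.m x (L.j y x) = x := by
    have huy : L.m u y = u := by
      have h := L.abs1 u y
      rwa [hy.1] at h
    have h := hcs.2 u y x
    rw [huy, hx.1] at h
    exact h.symm
  have join_right : L.j x (L.j y x) = L.j y x := by
    have h := L.abs3 x (L.j y x)
    rwa [meet_right] at h
  rw [← join_left, L.j_assoc, join_right]

theorem CoStronglyDistributive.nle_m (hcs : L.CoStronglyDistributive)
    (hx : L.nle u x) (hy : L.nle u y) : L.nle u (L.m x y) :=
  ⟨by rw [hcs.1, hx.1, hy.1], by rw [hcs.2, hx.2, hy.2]⟩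

theorem nle_j (hx : L.nle u x) (hy : L.nle u y) : L.nle u (L.j x y) :=
  ⟨by rw [← L.j_assoc, hx.1], by rw [L.j_assoc, hy.2]⟩

theorem CoStronglyDistributive.m_comm (hcs : L.CoStronglyDistributive)
    (hx : L.nle u x) (hy : L.nle u y) : L.m x y = L.m y x := by
  have hxy := hcs.nle_m hx hy
  have hyx := hcs.nle_m hy hx
  have h₁ : L.j (L.m x y) (L.m y x) = L.m y x := by
    rw [hcs.1, L.abs3, hcs.j_comm hxy hx, L.abs2]
  have h₂ : L.j (L.m y x) (L.m x y) = L.m x y := by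
    rw [hcs.1, L.abs3, hcs.j_comm hyx hy, L.abs2]
  rw [← h₂, hcs.j_comm hyx hxy, h₁]

/-- The upset of `u` in a co-strongly distributive skew lattice is a distributive lattice. -/
abbrev CoStronglyDistributive.upsetDistribLattice (hcs : L.CoStronglyDistributive) (u : S) :
    DistribLattice {w // L.nle u w} :=
  letI : Max {w // L.nle u w} := ⟨fun a b => ⟨L.j a b, nle_j a.2 b.2⟩⟩
  letI : Min {w // L.nle u w} := ⟨fun a b => ⟨L.m a b, hcs.nle_m a.2 b.2⟩⟩
  letI : Lattice {w // L.nle u w} := Lattice.mk'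
    (fun a b => Subtype.ext (hcs.j_comm a.2 b.2))
    (fun _ _ _ => Subtype.ext (L.j_assoc _ _ _))
    (fun a b => Subtype.ext (hcs.m_comm a.2 b.2))
    (fun _ _ _ => Subtype.ext (L.m_assoc _ _ _))
    (fun _ _ => Subtype.ext (L.abs2 _ _))
    (fun _ _ => Subtype.ext (L.abs1 _ _))
  { le_sup_inf := fun _ _ _ => le_of_eq (Subtype.ext (hcs.1 _ _ _).symm) }

theorem CoStronglyDistributive.eq_of_dRel (hcs : L.CoStronglyDistributive) {w t : S}
    (hw : L.nle u w) (h : L.dRel w t) : L.j (L.j u t) u = w := by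
  obtain ⟨huw, hwu⟩ := hw
  obtain ⟨htwt, hwtw⟩ := h
  unfold npre at htwt hwtw
  have ht : L.nle u (L.j (L.j u t) u) :=
    ⟨by rw [← L.j_assoc, ← L.j_assoc, L.j_idem], by rw [L.j_assoc, L.j_idem]⟩
  have hcomm := hcs.j_comm ⟨huw, hwu⟩ ht
  have h₁ : L.j w (L.j (L.j u t) u) = w := by
    calc L.j w (L.j (L.j u t) u)
        = L.j (L.j (L.j (L.j u t) u) w) w := by rw [hcomm, L.j_assoc _ w w, L.j_idem]
      _ = L.j (L.j w (L.j (L.j u t) u)) w := by rw [hcomm]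
      _ = L.j (L.j (L.j w u) t) (L.j u w) := by simp only [L.j_assoc]
      _ = w := by rw [hwu, huw, hwtw]
  have h₂ : L.j w (L.j (L.j u t) u) = L.j (L.j u t) u := by
    calc L.j w (L.j (L.j u t) u)
        = L.j w (L.j (L.j (L.j u t) u) (L.j (L.j u t) u)) := by rw [L.j_idem]
      _ = L.j (L.j (L.j (L.j u t) u) w) (L.j (L.j u t) u) := by rw [← hcomm, L.j_assoc w]
      _ = L.j (L.j u (L.j (L.j t (L.j (L.j u w) u)) t)) u := by simp only [L.j_assoc]
      _ = L.j (L.j u t) u := by rw [huw, hwu, htwt]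
  rw [← h₂, h₁]

theorem CoStronglyDistributive.finite_upset (hcs : L.CoStronglyDistributive)
    (hfin : ∃ T : Finset S, ∀ x : S, ∃ y ∈ T, L.dRel x y) (u : S) :
    Finite {w // L.nle u w} := by
  obtain ⟨T, hT⟩ := hfin
  refine Set.Finite.subset (T.finite_toSet.image fun t => L.j (L.j u t) u) fun w hw => ?_
  obtain ⟨t, ht, hwt⟩ := hT w
  exact ⟨t, ht, hcs.eq_of_dRel hw hwt⟩

theorem nle_antisymm (hxy : L.nle x y) (hyx : L.nle y x) : x = y := by
  rw [← hxy.1, hyx.2]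

theorem nle_refl (x : S) : L.nle x x := ⟨L.j_idem x, L.j_idem x⟩

theorem CoStronglyDistributive.exists_greatest (hcs : L.CoStronglyDistributive)
    (hfin : ∃ T : Finset S, ∀ x : S, ∃ y ∈ T, L.dRel x y) (hx : L.nle y x) :
    ∃ g, L.nle y g ∧ L.nle (L.m g x) y ∧
      ∀ w, L.nle y w → L.nle (L.m w x) y → L.nle w g := by
  classical
  let := hcs.upsetDistribLattice y
  have := hcs.finite_upset hfin y
  let := Fintype.ofFinite {w // L.nle y w}
  let : OrderBot {w // L.nle y w} :=
    { bot := ⟨y, nle_refl y⟩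
      bot_le := fun a => sup_eq_right.1 (Subtype.ext a.2.1) }
  let X : {w // L.nle y w} := ⟨x, hx⟩
  let G := (Finset.univ.filter fun w : {w // L.nle y w} => w ⊓ X = ⊥).sup id
  have hG : G ⊓ X = ⊥ := by
    rw [Finset.sup_inf_distrib_right, Finset.sup_eq_bot_iff]
    intro w hw
    exact (Finset.mem_filter.1 hw).2
  have hGval : L.m G x = y := congrArg Subtype.val hG
  refine ⟨G, G.2, by rw [hGval]; exact nle_refl y, fun w hw hwx => ?_⟩
  let W : {w // L.nle y w} := ⟨w, hw⟩
  have hW : W ⊓ X = ⊥ := Subtype.ext (nle_antisymm hwx (hcs.nle_m hw hx))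
  have hle : W ≤ G :=
    Finset.le_sup (f := id) (Finset.mem_filter.2 ⟨Finset.mem_univ W, hW⟩)
  exact ⟨congrArg Subtype.val (sup_eq_right.2 hle), congrArg Subtype.val (sup_eq_left.2 hle)⟩

end SkewLattice

/-- a co-strongly distributive skew lattice with top whose relation D
has only finitely many equivalence classes admits a skew Heyting implication. -/
theorem stmt_18 {S : Type*} (L : SkewLattice S) (one : S)
    (hcs : L.CoStronglyDistributive) (htop : L.IsTop one)
    (hfin : ∃ T : Finset S, ∀ x : S, ∃ y ∈ T, L.dRel x y) :
    ∃ h : S → S → S, L.IsSkewHeytingImp h := by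
  have hle : ∀ x y, L.nle y (L.j (L.j y x) y) := fun x y =>
    ⟨by rw [← L.j_assoc, ← L.j_assoc, L.j_idem], by rw [L.j_assoc, L.j_idem]⟩
  choose h hh using fun x y => hcs.exists_greatest hfin (hle x y)
  refine ⟨fun x y => h (L.j (L.j y x) y) y, fun x y => ?_, fun x y hyx => ?_⟩
  · simp only [(hle _ y).1, (hle _ y).2]
  · simpa only [hyx.1, hyx.2] using hh (L.j (L.j y x) y) y
end
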